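/- arXiv:1504.05544 — 2 statements merged into one kernel-verified Lean document; each statement's English description precedes it below -/
import Mathlib

section
/- Clifford's inequality for graphs: if D is a divisor on a finite connected graph of genus g such that both D and K_G − D have non-negative rank, then r(D) ≤ deg(D)/2. -/
namespace ChipFiring

open Finset

variable {V E : Type} [Fintype V] [DecidableEq V] [Fintype E] [DecidableEq E]

/-- The number of edges between the vertices `v` and `w` in the multigraph with
edge set `E` and endpoint maps `fst`, `snd`. -/
def mult (fst snd : E → V) (v w : V) : ℕ :=
  (univ.filter fun e => (fst e = v ∧ snd e = w) ∨ (fst e = w ∧ snd e = v)).card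

/-- The valence of a vertex: the number of edge-endpoints at it. -/
def valence (fst snd : E → V) (v : V) : ℕ := ∑ w, mult fst snd v w

/-- The degree of a divisor `D : V → ℤ`. -/
def deg (D : V → ℤ) : ℤ := ∑ v, D v

/-- The graph Laplacian applied to `f : V → ℤ`; this is the principal divisor `div f`,
with `div f (v) = Σ_{w adjacent to v} (f v - f w)` counted with edge multiplicity. -/
def lap (fst snd : E → V) (f : V → ℤ) : V → ℤ :=
  fun v => ∑ w, (mult fst snd v w : ℤ) * (f v - f w)

/-- Two divisors are linearly equivalent if they differ by a principal divisor. -/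
def LinEquiv (fst snd : E → V) (D D' : V → ℤ) : Prop :=
  ∃ f : V → ℤ, D - D' = lap fst snd f

/-- A divisor is effective if all its coefficients are nonnegative. -/
def Effective (D : V → ℤ) : Prop := ∀ v, 0 ≤ D v

/-- Adjacency: there is an edge between `v` and `w`. -/
def Adj (fst snd : E → V) (v w : V) : Prop :=
  ∃ e, (fst e = v ∧ snd e = w) ∨ (fst e = w ∧ snd e = v)

/-- The multigraph is connected. -/
def Connected (fst snd : E → V) : Prop :=
  ∀ v w : V, Relation.ReflTransGen (Adj fst snd) v w

/-- The multigraph has no loop edges. -/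
def Loopless (fst snd : E → V) : Prop := ∀ e, fst e ≠ snd e

/-- The chip-firing move at a vertex `v`. -/
def fire (fst snd : E → V) (v : V) (D : V → ℤ) : V → ℤ :=
  fun w => if w = v then D v - (valence fst snd v : ℤ) else D w + (mult fst snd v w : ℤ)

/-- `D` has rank at least `r`: subtracting any effective divisor of degree `r`
leaves a divisor linearly equivalent to an effective one. -/
def rankGe (fst snd : E → V) (D : V → ℤ) (r : ℕ) : Prop :=
  ∀ Ediv : V → ℤ, Effective Ediv → deg Ediv = (r : ℤ) →
    ∃ D', Effective D' ∧ LinEquiv fst snd (D - Ediv) D'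

/-- The Baker–Norine rank of a divisor: `-1` if `D` is not equivalent to an effective
divisor, and otherwise the largest `r ≥ 0` such that `rankGe` holds. -/
noncomputable def divRank (fst snd : E → V) (D : V → ℤ) : ℤ :=
  sSup {r : ℤ | r = -1 ∨ (0 ≤ r ∧ rankGe fst snd D r.toNat)}

/-- The canonical divisor `K_G = Σ_v (val v - 2) v`. -/
def canonical (fst snd : E → V) : V → ℤ := fun v => (valence fst snd v : ℤ) - 2

/-- The genus (first Betti number) `|E| - |V| + 1` of the multigraph. -/
def genus (V E : Type) [Fintype V] [Fintype E] : ℤ :=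
  (Fintype.card E : ℤ) - (Fintype.card V : ℤ) + 1

/-- The Laplacian as an additive group homomorphism. -/
def lapHom (fst snd : E → V) : (V → ℤ) →+ (V → ℤ) where
  toFun := lap fst snd
  map_zero' := by funext v; simp [lap]
  map_add' f g := by
    funext v
    simp only [lap, Pi.add_apply]
    rw [← Finset.sum_add_distrib]
    exact Finset.sum_congr rfl fun w _ => by ring

/-- The group of divisors of degree zero. -/
def Div0 (V : Type) [Fintype V] : AddSubgroup (V → ℤ) where
  carrier := {D | deg D = 0}
  zero_mem' := by simp [deg]
  add_mem' := by
    intro a b ha hb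
    have h : deg (a + b) = deg a + deg b := by
      simp [deg, Finset.sum_add_distrib]
    simp only [Set.mem_setOf_eq] at *
    omega
  neg_mem' := by
    intro a ha
    have h : deg (-a) = -deg a := by
      simp [deg]
    simp only [Set.mem_setOf_eq] at *
    omega

/-- The group of principal divisors: the image of the graph Laplacian. -/
def Prin (fst snd : E → V) : AddSubgroup (V → ℤ) := (lapHom fst snd).range

/-- The Jacobian (sandpile group) `Div⁰(G)/Prin(G)`. -/
abbrev Jac (fst snd : E → V) : Type _ :=
  Div0 V ⧸ (Prin fst snd).addSubgroupOf (Div0 V)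

section Helpers

variable {fst snd : E → V}

omit [DecidableEq E]

omit [Fintype V] in
theorem mult_comm (fst snd : E → V) (v w : V) : mult fst snd v w = mult fst snd w v := by
  unfold mult
  congr 1
  ext e
  simp only [mem_filter, mem_univ, true_and]
  exact or_comm

omit [Fintype V] in
theorem mult_self (hl : Loopless fst snd) (v : V) : mult fst snd v v = 0 := by
  unfold mult
  rw [card_eq_zero, filter_eq_empty_iff]
  rintro e - (⟨h₁, h₂⟩ | ⟨h₁, h₂⟩) <;> exact hl e (h₁.trans h₂.symm)

omit [Fintype V] in
theorem Adj.mult_pos {v w : V} (h : Adj fst snd v w) : 0 < mult fst snd v w := by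
  obtain ⟨e, he⟩ := h
  exact card_pos.mpr ⟨e, by simpa using he⟩

omit [DecidableEq V] in
theorem deg_add (D D' : V → ℤ) : deg (D + D') = deg D + deg D' := by
  simp [deg, sum_add_distrib]

omit [DecidableEq V] in
theorem deg_sub (D D' : V → ℤ) : deg (D - D') = deg D - deg D' := by
  simp [deg, sum_sub_distrib]

theorem deg_single (v : V) (a : ℤ) : deg (Pi.single v a) = a := by
  simp [deg]

omit [Fintype V] in
theorem Effective.single (v : V) {a : ℤ} (ha : 0 ≤ a) : Effective (Pi.single v a) := by
  intro w
  by_cases h : w = v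
  · subst h; simpa using ha
  · simp [h]

omit [Fintype V] [DecidableEq V] in
theorem Effective.add {D D' : V → ℤ} (h : Effective D) (h' : Effective D') :
    Effective (D + D') := fun v => add_nonneg (h v) (h' v)

omit [DecidableEq V] in
theorem Effective.deg_nonneg {D : V → ℤ} (h : Effective D) : 0 ≤ deg D :=
  sum_nonneg fun v _ => h v

theorem lap_add (f f' : V → ℤ) : lap fst snd (f + f') = lap fst snd f + lap fst snd f' :=
  map_add (lapHom fst snd) f f'

theorem lap_sub (f f' : V → ℤ) : lap fst snd (f - f') = lap fst snd f - lap fst snd f' :=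
  map_sub (lapHom fst snd) f f'

theorem lap_neg (f : V → ℤ) : lap fst snd (-f) = -lap fst snd f :=
  map_neg (lapHom fst snd) f

theorem lap_zsmul (n : ℤ) (f : V → ℤ) : lap fst snd (n • f) = n • lap fst snd f :=
  map_zsmul (lapHom fst snd) n f

theorem sum_mul_lap_comm (f g : V → ℤ) :
    ∑ v, g v * lap fst snd f v = ∑ v, f v * lap fst snd g v := by
  have key : ∀ a b : V → ℤ, ∑ v, a v * lap fst snd b v =
      (∑ v, ∑ w, (mult fst snd v w : ℤ) * (a v * b v)) -
        ∑ v, ∑ w, (mult fst snd v w : ℤ) * (a v * b w) := by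
    intro a b
    rw [← sum_sub_distrib]
    refine sum_congr rfl fun v _ => ?_
    rw [← sum_sub_distrib, lap, mul_sum]
    exact sum_congr rfl fun w _ => by ring
  rw [key, key]
  congr 1
  · exact sum_congr rfl fun v _ => sum_congr rfl fun w _ => by ring
  · rw [sum_comm]
    exact sum_congr rfl fun v _ => sum_congr rfl fun w _ => by rw [mult_comm]; ring

theorem deg_lap (f : V → ℤ) : deg (lap fst snd f) = 0 := by
  have h := sum_mul_lap_comm (fst := fst) (snd := snd) f 1
  have h1 : lap fst snd (1 : V → ℤ) = 0 := by funext v; simp [lap]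
  simpa [h1, deg] using h

theorem LinEquiv.deg_eq {D D' : V → ℤ} (h : LinEquiv fst snd D D') : deg D = deg D' := by
  obtain ⟨f, hf⟩ := h
  have := deg_lap (fst := fst) (snd := snd) f
  rw [← hf, deg_sub] at this
  omega

/-- If every nonempty set `A` contains a vertex related by `P` to the complement of `A`, then the
vertices can be ordered so that each one is related by `P` to the set of its predecessors. -/
theorem exists_order (P : V → Finset V → Prop)
    (hP : ∀ A : Finset V, A.Nonempty → ∃ v ∈ A, P v Aᶜ) :
    ∃ p : V → ℕ, Function.Injective p ∧ ∀ v, P v (univ.filter fun w => p w < p v) := by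
  suffices H : ∀ A : Finset V, ∃ p : V → ℕ, Set.InjOn p A ∧
      ∀ v ∈ A, P v (univ.filter fun w => w ∉ A ∨ p w < p v) by
    obtain ⟨p, hp, h⟩ := H univ
    refine ⟨p, by simpa using hp, fun v => by simpa using h v (mem_univ v)⟩
  intro A
  induction A using Finset.strongInduction with
  | H A ih =>
    rcases A.eq_empty_or_nonempty with rfl | hA
    · exact ⟨0, by simp, by simp⟩
    obtain ⟨v, hv, hPv⟩ := hP A hA
    obtain ⟨p, hp, h⟩ := ih _ (erase_ssubset hv)
    refine ⟨fun w => if w = v then 0 else p w + 1, ?_, ?_⟩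
    · intro x hx y hy hxy
      by_cases hxv : x = v <;> by_cases hyv : y = v
      · rw [hxv, hyv]
      · simp [hxv, hyv] at hxy
      · simp [hxv, hyv] at hxy
      · refine hp ?_ ?_ ?_
        · simpa [hxv] using hx
        · simpa [hyv] using hy
        · simpa [hxv, hyv] using hxy
    · intro u hu
      by_cases huv : u = v
      · subst huv
        convert hPv using 1
        ext w
        simp
      · convert h u (mem_erase.mpr ⟨huv, hu⟩) using 1
        ext w
        by_cases hwv : w = v <;> simp [huv, hwv]

/-- The divisor attached to the acyclic orientation in which edges point from smaller to larger
values of `p`. -/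
def orientDiv (fst snd : E → V) (p : V → ℤ) : V → ℤ :=
  fun v => (∑ w ∈ univ.filter fun w => p w < p v, (mult fst snd v w : ℤ)) - 1

theorem orientDiv_add_neg (hl : Loopless fst snd) {p : V → ℤ} (hp : Function.Injective p) :
    orientDiv fst snd p + orientDiv fst snd (-p) = canonical fst snd := by
  funext v
  have h : ((∑ w ∈ univ.filter fun w => p w < p v, (mult fst snd v w : ℤ)) +
      ∑ w ∈ univ.filter fun w => p v < p w, (mult fst snd v w : ℤ)) =
      ∑ w, (mult fst snd v w : ℤ) := by
    rw [sum_filter, sum_filter, ← sum_add_distrib]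
    refine sum_congr rfl fun w _ => ?_
    rcases lt_trichotomy (p w) (p v) with h | h | h
    · simp [h, h.le]
    · obtain rfl := hp h
      simp [mult_self hl]
    · simp [h, h.le]
  simp only [orientDiv, canonical, valence, Pi.add_apply, Pi.neg_apply, neg_lt_neg_iff]
  push_cast
  linarith

theorem deg_orientDiv_neg (p : V → ℤ) :
    deg (orientDiv fst snd (-p)) = deg (orientDiv fst snd p) := by
  simp only [deg, orientDiv, sum_sub_distrib, Pi.neg_apply, neg_lt_neg_iff, sum_filter]
  congr 1
  rw [sum_comm]
  exact sum_congr rfl fun v _ => sum_congr rfl fun w _ => by rw [mult_comm]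

theorem not_linEquiv_of_effective_orientDiv [Nonempty V] (p : V → ℤ) {D : V → ℤ}
    (hD : Effective D) : ¬ LinEquiv fst snd (orientDiv fst snd p) D := by
  rintro ⟨f, hf⟩
  obtain ⟨m, hm⟩ := Finite.exists_max f
  obtain ⟨v, hv, hmin⟩ := exists_min_image (univ.filter fun v => f v = f m) p ⟨m, by simp⟩
  simp only [mem_filter, mem_univ, true_and] at hv hmin
  have h := congrFun hf v
  have hle : (∑ w ∈ univ.filter fun w => p w < p v, (mult fst snd v w : ℤ)) ≤
      lap fst snd f v := by
    rw [lap, sum_filter]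
    refine sum_le_sum fun w _ => ?_
    have hw := hm w
    split_ifs with hlt
    · have : f w ≠ f m := fun h => absurd (hmin w h) (not_le.mpr hlt)
      exact le_mul_of_one_le_right (by positivity) (by omega)
    · exact mul_nonneg (by positivity) (by omega)
  have := hD v
  simp only [Pi.sub_apply, orientDiv] at h
  linarith

omit [Fintype E] in
theorem exists_adj_predecessor_order (hc : Connected fst snd) (v₀ : V) :
    ∃ p : V → ℕ, ∀ v, v ≠ v₀ → ∃ u, Adj fst snd v u ∧ p u < p v := by
  obtain ⟨p, -, hp⟩ := exists_order (fun v B => v ≠ v₀ → ∃ u ∈ B, Adj fst snd v u) (by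
    rintro A ⟨a, ha⟩
    by_cases h₀ : v₀ ∈ A
    · exact ⟨v₀, h₀, fun h => absurd rfl h⟩
    by_contra! hA
    have hmem : ∀ x, Relation.ReflTransGen (Adj fst snd) a x → x ∈ A := by
      intro x hx
      induction hx with
      | refl => exact ha
      | tail _ hbc ih =>
        by_contra hcA
        exact (hA _ ih).2 _ (by simpa using hcA) hbc
    exact h₀ (hmem _ (hc a v₀)))
  refine ⟨p, fun v hv => ?_⟩
  obtain ⟨u, hu, huv⟩ := hp v hv
  exact ⟨u, huv, by simpa using hu⟩

theorem exists_lap_pos (hc : Connected fst snd) (v₀ : V) :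
    ∃ g : V → ℤ, g v₀ = 0 ∧ (∀ v, 0 ≤ g v) ∧ ∀ v, v ≠ v₀ → 1 ≤ lap fst snd g v := by
  obtain ⟨p, hp⟩ := exists_adj_predecessor_order hc v₀
  set B : ℕ := 1 + ∑ v, valence fst snd v
  set n : ℕ := ∑ v, p v
  set h : V → ℤ := fun v => (B : ℤ) ^ (n - p v) with hh
  have hpos : ∀ v, 0 < h v := fun v => by
    have : 0 < B := by omega
    positivity
  have hlap : ∀ v, v ≠ v₀ → lap fst snd h v < 0 := by
    intro v hv
    obtain ⟨u, huv, hlt⟩ := hp v hv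
    have hn : p v ≤ n := single_le_sum (f := p) (fun _ _ => Nat.zero_le _) (mem_univ v)
    have hB : valence fst snd v + 1 ≤ B := by
      have := single_le_sum (f := valence fst snd) (fun _ _ => Nat.zero_le _) (mem_univ v)
      omega
    have hu : (B : ℤ) * h v ≤ h u := by
      simp only [hh]
      rw [← pow_succ']
      exact pow_le_pow_right₀ (by exact_mod_cast (by omega : 1 ≤ B)) (by omega)
    have hmu : h u ≤ ∑ w, (mult fst snd v w : ℤ) * h w := by
      refine le_trans ?_ (single_le_sum (f := fun w => (mult fst snd v w : ℤ) * h w)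
        (fun w _ => mul_nonneg (by positivity) (hpos w).le) (mem_univ u))
      have : (1 : ℤ) ≤ mult fst snd v u := by exact_mod_cast huv.mult_pos
      exact le_mul_of_one_le_left (hpos u).le this
    have hsum : lap fst snd h v =
        (valence fst snd v : ℤ) * h v - ∑ w, (mult fst snd v w : ℤ) * h w := by
      simp only [lap, valence, mul_sub, sum_sub_distrib]
      push_cast
      rw [sum_mul]
    have hB' : ((valence fst snd v : ℤ) + 1) * h v ≤ B * h v :=
      mul_le_mul_of_nonneg_right (by exact_mod_cast hB) (hpos v).le
    have := hpos v
    linarith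
  have hmax : ∀ v, h v ≤ h v₀ := by
    have : Nonempty V := ⟨v₀⟩
    obtain ⟨m, hm⟩ := Finite.exists_max h
    by_cases hmv : m = v₀
    · exact hmv ▸ hm
    · refine absurd (hlap m hmv) (not_lt.mpr (sum_nonneg fun w _ => ?_))
      exact mul_nonneg (by positivity) (sub_nonneg.mpr (hm w))
  refine ⟨fun v => h v₀ - h v, by simp, fun v => sub_nonneg.mpr (hmax v), fun v hv => ?_⟩
  have heq : lap fst snd (fun v => h v₀ - h v) v = -lap fst snd h v := by
    simp only [lap, ← sum_neg_distrib]
    exact sum_congr rfl fun w _ => by ring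
  have := hlap v hv
  omega

/-- Every divisor is equivalent to a `v₀`-reduced one. -/
theorem exists_reduced (hc : Connected fst snd) (D : V → ℤ) (v₀ : V) :
    ∃ f : V → ℤ, (∀ v, v ≠ v₀ → 0 ≤ (D - lap fst snd f) v) ∧
      ∀ A : Finset V, A.Nonempty → v₀ ∉ A →
        ∃ v ∈ A, (D - lap fst snd f) v < ∑ w ∈ Aᶜ, (mult fst snd v w : ℤ) := by
  obtain ⟨g, hg₀, hg, hlap⟩ := exists_lap_pos hc v₀
  let S : Set (V → ℤ) := {f | ∀ v, v ≠ v₀ → 0 ≤ (D - lap fst snd f) v}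
  let Φ : (V → ℤ) → ℤ := fun f => ∑ v, g v * (D - lap fst snd f) v
  have hS : S.Nonempty := by
    refine ⟨-((∑ v, |D v|) • g), fun v hv => ?_⟩
    have h1 : |D v| ≤ ∑ v, |D v| :=
      single_le_sum (f := fun v => |D v|) (fun _ _ => abs_nonneg _) (mem_univ v)
    have h2 : (∑ v, |D v|) * 1 ≤ (∑ v, |D v|) * lap fst snd g v :=
      mul_le_mul_of_nonneg_left (hlap v hv) (sum_nonneg fun _ _ => abs_nonneg _)
    have h3 := neg_abs_le (D v)
    simp only [lap_neg, lap_zsmul, Pi.sub_apply, Pi.neg_apply, Pi.smul_apply, smul_eq_mul]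
    linarith
  have hΦ : ∀ f ∈ S, 0 ≤ Φ f := by
    intro f hf
    refine sum_nonneg fun v _ => ?_
    by_cases hv : v = v₀
    · simp [hv, hg₀]
    · exact mul_nonneg (hg v) (hf v hv)
  obtain ⟨f, hf, hmin⟩ : ∃ f ∈ S, ∀ f' ∈ S, (Φ f).toNat ≤ (Φ f').toNat :=
    ⟨Function.argminOn (fun f => (Φ f).toNat) S hS, Function.argminOn_mem _ _ _,
      fun f' hf' => Function.argminOn_le (fun f => (Φ f).toNat) S hf'⟩
  refine ⟨f, hf, fun A hA h₀ => ?_⟩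
  by_contra! hcon
  let χ : V → ℤ := fun v => if v ∈ A then 1 else 0
  have hfχ : f + χ ∈ S := by
    intro v hv
    have hfv := hf v hv
    rw [lap_add, ← sub_sub, Pi.sub_apply]
    by_cases hvA : v ∈ A
    · have : lap fst snd χ v = ∑ w ∈ Aᶜ, (mult fst snd v w : ℤ) := by
        rw [compl_eq_univ_sdiff, ← filter_notMem_eq_sdiff, sum_filter, lap]
        refine sum_congr rfl fun w _ => ?_
        by_cases hw : w ∈ A <;> simp [χ, hvA, hw]
      rw [this]
      exact sub_nonneg.mpr (hcon v hvA)
    · have : lap fst snd χ v ≤ 0 := by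
        refine sum_nonpos fun w _ => ?_
        by_cases hw : w ∈ A <;> simp [χ, hvA, hw]
      linarith
  have hdec : Φ (f + χ) < Φ f := by
    have h1 : Φ (f + χ) = Φ f - ∑ v, g v * lap fst snd χ v := by
      simp only [Φ]
      rw [← sum_sub_distrib]
      refine sum_congr rfl fun v _ => ?_
      rw [lap_add]
      simp only [Pi.sub_apply, Pi.add_apply]
      ring
    have h2 : 0 < ∑ v, g v * lap fst snd χ v := by
      rw [sum_mul_lap_comm]
      have : ∑ v, χ v * lap fst snd g v = ∑ v ∈ A, lap fst snd g v := by
        simp [χ, sum_ite_mem]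
      rw [this]
      refine sum_pos (fun v hv => ?_) hA
      have := hlap v (fun h => h₀ (h ▸ hv))
      omega
    omega
  have := hmin _ hfχ
  have := hΦ _ hfχ
  omega

/-- A divisor which is not equivalent to an effective one is dominated, up to equivalence, by the
divisor of an acyclic orientation. -/
theorem exists_orientDiv_sub_effective [Nonempty V] (hc : Connected fst snd) {D : V → ℤ}
    (hD : ¬ ∃ D', Effective D' ∧ LinEquiv fst snd D D') :
    ∃ p : V → ℤ, Function.Injective p ∧
      ∃ F, Effective F ∧ LinEquiv fst snd (orientDiv fst snd p - D) F := by
  obtain ⟨v₀⟩ := ‹Nonempty V›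
  obtain ⟨f, hf, hred⟩ := exists_reduced hc D v₀
  have hneg : (D - lap fst snd f) v₀ < 0 := by
    by_contra! h
    refine hD ⟨D - lap fst snd f, fun v => ?_, f, by simp⟩
    by_cases hv : v = v₀
    · rwa [hv]
    · exact hf v hv
  obtain ⟨p, hp, h⟩ := exists_order
    (fun v B => (D - lap fst snd f) v < ∑ w ∈ B, (mult fst snd v w : ℤ)) (by
      intro A hA
      by_cases h₀ : v₀ ∈ A
      · exact ⟨v₀, h₀, hneg.trans_le (sum_nonneg fun _ _ => by positivity)⟩
      · exact hred A hA h₀)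
  refine ⟨fun v => p v, fun x y hxy => hp (Nat.cast_injective hxy),
    orientDiv fst snd (fun v => p v) - (D - lap fst snd f), fun v => ?_, -f, ?_⟩
  · have := h v
    simp only [orientDiv, Nat.cast_lt, Pi.sub_apply] at this ⊢
    omega
  · rw [lap_neg]
    abel

theorem rankGe.mono [Nonempty V] {D : V → ℤ} {r t : ℕ} (h : rankGe fst snd D r) (htr : t ≤ r) :
    rankGe fst snd D t := by
  intro F hF hdeg
  obtain ⟨v₀⟩ := ‹Nonempty V›
  have hs : Effective (Pi.single v₀ ((r : ℤ) - t)) := Effective.single v₀ (by omega)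
  obtain ⟨D', hD', f, hf⟩ := h (F + Pi.single v₀ ((r : ℤ) - t)) (hF.add hs) (by
    rw [deg_add, deg_single]; omega)
  exact ⟨D' + Pi.single v₀ ((r : ℤ) - t), hD'.add hs, f, by rw [← hf]; abel⟩

theorem rankGe.le_deg [Nonempty V] {D : V → ℤ} {r : ℕ} (h : rankGe fst snd D r) :
    (r : ℤ) ≤ deg D := by
  obtain ⟨v₀⟩ := ‹Nonempty V›
  obtain ⟨D', hD', hlin⟩ := h (Pi.single v₀ (r : ℤ)) (Effective.single v₀ (by omega))
    (deg_single _ _)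
  have := hlin.deg_eq
  rw [deg_sub, deg_single] at this
  have := hD'.deg_nonneg
  omega

theorem Effective.exists_split {F : V → ℤ} (hF : Effective F) (r : ℕ) (hr : (r : ℤ) ≤ deg F) :
    ∃ F', Effective F' ∧ deg F' = r ∧ Effective (F - F') := by
  induction r with
  | zero => exact ⟨0, fun _ => le_rfl, by simp [deg], by simpa using hF⟩
  | succ r ih =>
    obtain ⟨F', hF', hdeg, hsub⟩ := ih (by push_cast at hr; omega)
    obtain ⟨v, hv⟩ : ∃ v, 0 < (F - F') v := by
      by_contra! h
      have h0 : deg (F - F') ≤ 0 := sum_nonpos fun v _ => h v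
      rw [deg_sub] at h0
      push_cast at hr
      omega
    refine ⟨F' + Pi.single v 1, hF'.add (Effective.single v zero_le_one), ?_, fun w => ?_⟩
    · rw [deg_add, deg_single, hdeg]; push_cast; rfl
    · have := hsub w
      by_cases hw : w = v
      · subst hw
        simp only [Pi.sub_apply, Pi.add_apply, Pi.single_eq_same] at hv ⊢
        omega
      · simpa [hw] using this

theorem rankGe.add {D D' : V → ℤ} {r s : ℕ} (h : rankGe fst snd D r)
    (h' : rankGe fst snd D' s) : rankGe fst snd (D + D') (r + s) := by
  intro F hF hdeg
  push_cast at hdeg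
  obtain ⟨F', hF', hd', hsub⟩ := hF.exists_split r (by omega)
  obtain ⟨C, hC, f, hf⟩ := h F' hF' hd'
  obtain ⟨C', hC', f', hf'⟩ := h' (F - F') hsub (by rw [deg_sub]; omega)
  exact ⟨C + C', hC.add hC', f + f', by rw [lap_add, ← hf, ← hf']; abel⟩

/-- One inequality of the Riemann–Roch theorem for graphs. -/
theorem rankGe.lt_of_not_rankGe_canonical_sub [Nonempty V] (hl : Loopless fst snd)
    (hc : Connected fst snd) {D : V → ℤ} {r s : ℕ} (hr : rankGe fst snd D r)
    (hs : ¬ rankGe fst snd (canonical fst snd - D) s) :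
    ∃ k, deg (canonical fst snd) = 2 * k ∧ (r : ℤ) < deg D - k + s := by
  unfold rankGe at hs
  push Not at hs
  obtain ⟨C, hC, hdegC, hne⟩ := hs
  obtain ⟨p, hp, F, hF, hlin⟩ := exists_orientDiv_sub_effective hc
    (not_exists.mpr fun D' h => hne D' h.1 h.2)
  have hK : orientDiv fst snd p + orientDiv fst snd (-p) = canonical fst snd :=
    orientDiv_add_neg hl hp
  have hdegK : deg (canonical fst snd) = 2 * deg (orientDiv fst snd p) := by
    rw [← hK, deg_add, deg_orientDiv_neg]; ring
  refine ⟨deg (orientDiv fst snd p), hdegK, ?_⟩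
  have hdegF := hlin.deg_eq
  simp only [deg_sub] at hdegF
  by_contra! hcon
  have hF0 := hF.deg_nonneg
  obtain ⟨D', hD', f', hf'⟩ := hr.mono (t := (deg F).toNat) (by omega) F hF (by omega)
  obtain ⟨f, hf⟩ := hlin
  refine not_linEquiv_of_effective_orientDiv (fst := fst) (snd := snd) (-p) (hD'.add hC)
    ⟨f' - f, ?_⟩
  rw [lap_sub, ← hf, ← hf', ← hK]
  abel

theorem rankGe_divRank [Nonempty V] {D : V → ℤ} (hD : 0 ≤ divRank fst snd D) :
    rankGe fst snd D (divRank fst snd D).toNat ∧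
      ¬ rankGe fst snd D ((divRank fst snd D).toNat + 1) := by
  have hbdd : BddAbove {r : ℤ | r = -1 ∨ (0 ≤ r ∧ rankGe fst snd D r.toNat)} := by
    refine ⟨max (-1) (deg D), ?_⟩
    rintro r (rfl | ⟨h0, h⟩)
    · exact le_max_left _ _
    · have := h.le_deg
      exact le_max_of_le_right (by omega)
  have hmem : divRank fst snd D ∈ {r : ℤ | r = -1 ∨ (0 ≤ r ∧ rankGe fst snd D r.toNat)} :=
    Int.csSup_mem ⟨-1, Or.inl rfl⟩ hbdd
  refine ⟨?_, fun h => ?_⟩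
  · rcases hmem with h | h
    · omega
    · exact h.2
  · have hle : divRank fst snd D + 1 ≤ divRank fst snd D := by
      refine le_csSup hbdd (Or.inr ⟨by omega, ?_⟩)
      rwa [show (divRank fst snd D + 1).toNat = (divRank fst snd D).toNat + 1 by omega]
    omega

theorem divRank_of_isEmpty [IsEmpty V] (D : V → ℤ) : divRank fst snd D = 0 := by
  refine Int.csSup_of_not_bddAbove ?_
  rintro ⟨b, hb⟩
  have : max 1 (b + 1) ≤ b := by
    refine hb (Or.inr ⟨by omega, fun F _ hdeg => ?_⟩)
    simp [deg] at hdeg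
    omega
  omega

end Helpers

/-- Clifford's inequality for graphs: if `D` and `K_G - D` both have
non-negative rank, then `r(D) ≤ deg(D)/2`. -/
theorem graph_clifford
    (fst snd : E → V) (hl : Loopless fst snd) (hc : Connected fst snd)
    (D : V → ℤ) (hD : 0 ≤ divRank fst snd D)
    (hKD : 0 ≤ divRank fst snd (canonical fst snd - D)) :
    2 * divRank fst snd D ≤ deg D := by
  rcases isEmpty_or_nonempty V with hV | hV
  · simp [divRank_of_isEmpty, deg]
  obtain ⟨hr, -⟩ := rankGe_divRank hD
  obtain ⟨hs, hs'⟩ := rankGe_divRank hKD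
  have hadd := hr.add hs
  rw [add_sub_cancel] at hadd
  have hzero : ¬ rankGe fst snd (canonical fst snd - canonical fst snd) 1 := by
    intro h
    have := h.le_deg
    simp [deg] at this
  obtain ⟨k, hk, h₁⟩ := hr.lt_of_not_rankGe_canonical_sub hl hc hs'
  obtain ⟨k', hk', h₂⟩ := hadd.lt_of_not_rankGe_canonical_sub hl hc hzero
  push_cast at h₁ h₂
  omega

end ChipFiring
end

section
/- For the complete graph K_4 with all edges of unit length (as a finite graph), no divisor of degree 2 has rank 1; i.e., K_4 is not hyperelliptic. -/
namespace ChipFiring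

open Finset

variable {V E : Type} [Fintype V] [DecidableEq V] [Fintype E] [DecidableEq E]

theorem rankGe_of_divRank_eq {W F : Type} [Fintype W] [DecidableEq W] [Fintype F]
    {fst snd : F → W} {D : W → ℤ} {r : ℕ} (hr : r ≠ 0)
    (h : divRank fst snd D = r) : rankGe fst snd D r := by
  unfold divRank at h
  set S := {r : ℤ | r = -1 ∨ (0 ≤ r ∧ rankGe fst snd D r.toNat)}
  have hne : S.Nonempty := ⟨-1, Or.inl rfl⟩
  have hbdd : BddAbove S := by
    by_contra hb
    rw [Int.csSup_of_not_bddAbove hb] at h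
    omega
  have hmem := Int.csSup_mem hne hbdd
  rw [h] at hmem
  rcases hmem with h' | ⟨-, h'⟩
  · omega
  · simpa using h'

theorem mult_K4 (v w : Fin 4) :
    mult (E := {p : Fin 4 × Fin 4 // p.1 < p.2}) (fun e => e.1.1) (fun e => e.1.2) v w =
      if v = w then 0 else 1 := by
  revert v w
  decide

theorem lap_K4 (f : Fin 4 → ℤ) (v : Fin 4) :
    lap (E := {p : Fin 4 × Fin 4 // p.1 < p.2}) (fun e => e.1.1) (fun e => e.1.2) f v =
      4 * f v - ∑ w, f w := by
  simp only [lap, mult_K4]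
  fin_cases v <;> simp [Fin.sum_univ_four] <;> ring

theorem eq_single_of_effective_of_deg_eq_one {D : Fin 4 → ℤ} (hD : Effective D)
    (h : deg D = 1) : ∃ u, D = Pi.single u 1 := by
  simp only [deg, Fin.sum_univ_four] at h
  have h0 := hD 0
  have h1 := hD 1
  have h2 := hD 2
  have h3 := hD 3
  obtain hu | hu | hu | hu : D 0 = 1 ∨ D 1 = 1 ∨ D 2 = 1 ∨ D 3 = 1 := by omega
  · exact ⟨0, by ext i; fin_cases i <;> simp <;> omega⟩
  · exact ⟨1, by ext i; fin_cases i <;> simp <;> omega⟩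
  · exact ⟨2, by ext i; fin_cases i <;> simp <;> omega⟩
  · exact ⟨3, by ext i; fin_cases i <;> simp <;> omega⟩

/-- A divisor of degree 2 and rank at least 1 on `K₄` is, modulo 4 and up to a constant,
the sum of any given vertex and some other vertex. -/
theorem exists_cast_eq_of_rankGe_K4 {D : Fin 4 → ℤ} (hD : deg D = 2)
    (h : rankGe (E := {p : Fin 4 × Fin 4 // p.1 < p.2})
      (fun e => e.1.1) (fun e => e.1.2) D 1) (v : Fin 4) :
    ∃ (u : Fin 4) (c : ZMod 4), ∀ i, (D i : ZMod 4) =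
      (if i = v then 1 else 0) + (if i = u then 1 else 0) + c := by
  have hv : Effective (Pi.single v 1 : Fin 4 → ℤ) := fun i => by
    rw [Pi.single_apply]
    split_ifs <;> simp
  have hdeg : deg (Pi.single v 1 : Fin 4 → ℤ) = 1 := by simp [deg]
  obtain ⟨D', hD', f, hf⟩ := h _ hv (by simpa using hdeg)
  have key (i : Fin 4) : D i = (Pi.single v 1 : Fin 4 → ℤ) i + D' i + (4 * f i - ∑ w, f w) := by
    have := congrFun hf i
    rw [lap_K4] at this
    simp only [Pi.sub_apply] at this
    linarith
  have hD'deg : deg D' = 1 := by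
    simp only [deg] at hD hdeg ⊢
    simp only [key, sum_add_distrib, sum_sub_distrib, ← mul_sum, hdeg] at hD
    simp only [sum_const, card_univ, Fintype.card_fin, nsmul_eq_mul] at hD
    push_cast at hD
    linarith
  obtain ⟨u, rfl⟩ := eq_single_of_effective_of_deg_eq_one hD' hD'deg
  refine ⟨u, ((-∑ w, f w : ℤ) : ZMod 4), fun i => ?_⟩
  have h4 : (4 : ZMod 4) = 0 := rfl
  rw [key i, Pi.single_apply, Pi.single_apply]
  push_cast
  rw [h4]
  ring

theorem single_add_single_ne_mod_four (u v w : Fin 4) (c : ZMod 4) (hv : v ≠ 0) (hu : v ≠ u) :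
    ¬ ∀ i : Fin 4, ((if i = 0 then 1 else 0) + (if i = u then 1 else 0) : ZMod 4) =
      (if i = v then 1 else 0) + (if i = w then 1 else 0) + c := by
  revert u v w c
  decide

/-- the complete graph `K₄` is not hyperelliptic: no divisor of
degree 2 on it has rank 1. -/
theorem K4_not_hyperelliptic :
    ¬ ∃ D : Fin 4 → ℤ, deg D = 2 ∧
      divRank (V := Fin 4) (E := {p : Fin 4 × Fin 4 // p.1 < p.2})
        (fun e => e.1.1) (fun e => e.1.2) D = 1 := by
  rintro ⟨D, hD, hr⟩
  have h := exists_cast_eq_of_rankGe_K4 hD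
    (rankGe_of_divRank_eq one_ne_zero (by simpa using hr))
  obtain ⟨u, c, hu⟩ := h 0
  obtain ⟨v, hv, hvu⟩ : ∃ v : Fin 4, v ≠ 0 ∧ v ≠ u := by
    clear hu
    revert u
    decide
  obtain ⟨w, c', hw⟩ := h v
  refine single_add_single_ne_mod_four u v w (c' - c) hv hvu fun i => ?_
  linear_combination hw i - hu i

end ChipFiring
end
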